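/- Let u ≥ 2 and let F be a fixed nice u-graph with r = v(F) ≥ 4 vertices and s = e(F) edges, fix δ > 0, fix g = g(n) with g(n) → ∞ and g(n) = o(log n/log log n), and set π_+ = (aut(F)/r!)·(log n + g(n))/binom(n−1,r−1) and p_+ = (π_+/(1−n^{−δ}))^{1/s}. Then for every ε > 0 there is n_0 such that for all n ≥ n_0 the following deterministic bound holds. Let H_0 be any F-graph on [n] such that no vertex of H_0 has degree more than d̄(π_+) + max(d̄(π_+), 3 log n), where d̄(π) = (r/n)·M·π, and such that the r-uniform multihypergraph of vertex sets of the F-edges of H_0 contains no avoidable configuration. Let G_0 be the u-graph union of the u-edge sets of all copies belonging to H_0, and let v be any vertex whose degree in H_0 is at most 7g(n). Then the sum, over all F-edges h_j ∉ H_0 whose vertex set contains v, of (p_+^{|E_j \ E(G_0)|} − p_+^{s}), where E_j is the u-edge set of the copy corresponding to h_j, is at most n^{−1/s + ε}. -/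

import Mathlib

open Classical Filter Asymptotics MeasureTheory
open scoped ENNReal

noncomputable section

/-- The type of potential `F`-edges on vertex set `Fin n`: a pair consisting of the
`r`-element vertex set of the copy and the `u`-edge set of the copy. -/
abbrev FE (n : ℕ) := Finset (Fin n) × Finset (Finset (Fin n))

/-- `F` (a `u`-graph on `Fin r`) is strictly 1-balanced: every proper subgraph `(V', E')`
with more than one vertex has strictly smaller 1-density, i.e.
`e'/(v'-1) < e(F)/(r-1)`, written multiplicatively. -/
def StrictlyOneBalanced {r : ℕ} (F : Finset (Finset (Fin r))) : Prop :=
  ∀ (V' : Finset (Fin r)) (E' : Finset (Finset (Fin r))),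
    E' ⊆ F → (∀ e ∈ E', e ⊆ V') → 1 < V'.card → ¬(V' = Finset.univ ∧ E' = F) →
      E'.card * (r - 1) < F.card * (V'.card - 1)

/-- After deleting the vertices in `S`, the hypergraph `F` is connected. -/
def ConnectedAvoiding {r : ℕ} (F : Finset (Finset (Fin r))) (S : Finset (Fin r)) : Prop :=
  ∀ x y : Fin r, x ∉ S → y ∉ S →
    Relation.ReflTransGen (fun a b => ∃ e ∈ F, Disjoint e S ∧ a ∈ e ∧ b ∈ e) x y

/-- `F` is 3-connected: at least 4 vertices, and no set of at most 2 vertices disconnects it. -/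
def ThreeConnected {r : ℕ} (F : Finset (Finset (Fin r))) : Prop :=
  4 ≤ r ∧ ∀ S : Finset (Fin r), S.card ≤ 2 → ConnectedAvoiding F S

/-- Two edge sets on `Fin r` are isomorphic via a permutation of the vertices. -/
def EdgeIso {r : ℕ} (F F' : Finset (Finset (Fin r))) : Prop :=
  ∃ σ : Equiv.Perm (Fin r), F.image (fun e => e.image (fun x => σ x)) = F'

/-- `F` is nice: strictly 1-balanced, 3-connected and either `u ≥ 3` or `u = 2` and `F`
cannot be transformed into an isomorphic graph by adding one edge and deleting one edge. -/
def Nice {r : ℕ} (u : ℕ) (F : Finset (Finset (Fin r))) : Prop :=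
  StrictlyOneBalanced F ∧ ThreeConnected F ∧
    (3 ≤ u ∨ (u = 2 ∧ ¬ ∃ a b : Finset (Fin r), a.card = u ∧ a ∉ F ∧ b ∈ F ∧
      EdgeIso (insert a (F.erase b)) F))

/-- `h` is an `F`-edge on `[n]`: a copy of `F`, recorded as its (`r`-element) vertex set
together with its `u`-edge set. -/
def IsFEdge {r : ℕ} (F : Finset (Finset (Fin r))) (n : ℕ) (h : FE n) : Prop :=
  ∃ φ : Fin r ↪ Fin n, h.1 = Finset.univ.map φ ∧ h.2 = F.image (fun e => e.map φ)

/-- All possible `F`-edges on `[n]`. -/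
def allFEdges {r : ℕ} (F : Finset (Finset (Fin r))) (n : ℕ) : Finset (FE n) :=
  Finset.univ.filter (fun h => IsFEdge F n h)

/-- `M`, the total number of `F`-edges on `[n]`. -/
def Mnum {r : ℕ} (F : Finset (Finset (Fin r))) (n : ℕ) : ℕ := (allFEdges F n).card

/-- All `u`-element subsets of `[n]`. -/
def allUEdges (u n : ℕ) : Finset (Finset (Fin n)) :=
  Finset.univ.filter (fun e : Finset (Fin n) => e.card = u)

/-- The number of automorphisms of `F`. -/
def autCard {r : ℕ} (F : Finset (Finset (Fin r))) : ℕ :=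
  Fintype.card {σ : Equiv.Perm (Fin r) // F.image (fun e => e.image (fun x => σ x)) = F}

/-- The degree of a vertex `v` in an `F`-graph `H`. -/
def degFE {n : ℕ} (H : Finset (FE n)) (v : Fin n) : ℕ :=
  (H.filter (fun h => v ∈ h.1)).card

/-- Two `F`-edges are partners if their vertex sets share exactly `u` vertices. -/
def Partner (u : ℕ) {n : ℕ} (h h' : FE n) : Prop :=
  h ≠ h' ∧ (h.1 ∩ h'.1).card = u

/-- The state at time `t` of the process induced by the ordering `f`. -/
def proc {α : Type*} [DecidableEq α] {m : ℕ} (f : Fin m → α) (t : ℕ) : Finset α :=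
  (Finset.univ.filter (fun i : Fin m => (i : ℕ) < t)).image f

/-- A valid ordering of all `u`-element subsets of `[n]`. -/
def ValidOrdU (u n : ℕ) (f : Fin (Nat.choose n u) → Finset (Fin n)) : Prop :=
  Function.Injective f ∧ ∀ e : Finset (Fin n), e.card = u → ∃ i, f i = e

/-- A valid ordering of all `r`-element subsets of `[n]`. -/
def ValidOrdR (r n : ℕ) (f : Fin (Nat.choose n r) → Finset (Fin n)) : Prop :=
  Function.Injective f ∧ ∀ e : Finset (Fin n), e.card = r → ∃ i, f i = e

/-- A valid ordering of all `F`-edges on `[n]`. -/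
def ValidOrdH {r : ℕ} (F : Finset (Finset (Fin r))) (n : ℕ)
    (f : Fin (Mnum F n) → FE n) : Prop :=
  Function.Injective f ∧ ∀ h : FE n, IsFEdge F n h → ∃ i, f i = h

/-- `T_H`: the first time at which the `F`-graph process has no isolated vertices. -/
def THit {r : ℕ} (F : Finset (Finset (Fin r))) (n : ℕ) (f : Fin (Mnum F n) → FE n) : ℕ :=
  sInf {t : ℕ | ∀ v : Fin n, ∃ h ∈ proc f t, v ∈ h.1}

/-- `T_E`: the first time at which the `r`-uniform hypergraph process has no isolated
vertices. -/
def TEHit (r n : ℕ) (f : Fin (Nat.choose n r) → Finset (Fin n)) : ℕ :=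
  sInf {t : ℕ | ∀ v : Fin n, ∃ e ∈ proc f t, v ∈ e}

/-- `T_G`: the first time at which every vertex of `[n]` lies in a copy of `F` in the
`u`-graph process. -/
def TGHit (u : ℕ) {r : ℕ} (F : Finset (Finset (Fin r))) (n : ℕ)
    (f : Fin (Nat.choose n u) → Finset (Fin n)) : ℕ :=
  sInf {t : ℕ | ∀ v : Fin n, ∃ h : FE n, IsFEdge F n h ∧ v ∈ h.1 ∧ h.2 ⊆ proc f t}

/-- The random variable `X` is uniformly distributed over `{a | P a}` under `μ`. -/
def UniformOn {Ω α : Type*} (μ : PMF Ω) (X : Ω → α) (P : α → Prop) : Prop :=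
  μ.toOuterMeasure {ω | P (X ω)} = 1 ∧
    ∀ a b : α, P a → P b →
      μ.toOuterMeasure {ω | X ω = a} = μ.toOuterMeasure {ω | X ω = b}

/-- Under `μ`, the random set `X` contains each element of `all` independently with
probability `p` (a Bernoulli product / binomial random subset distribution). -/
def BernoulliVia {Ω E : Type*} (μ : PMF Ω) (X : Ω → Finset E)
    (all : Finset E) (p : ℝ) : Prop :=
  ∀ A : Finset E, μ.toOuterMeasure {ω | X ω = A} =
    if A ⊆ all then ENNReal.ofReal (p ^ A.card * (1 - p) ^ (all.card - A.card)) else 0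

/-- The function `g` tends to infinity and is `o(log n / log log n)`. -/
def GoodG (g : ℕ → ℝ) : Prop :=
  Tendsto g atTop atTop ∧ g =o[atTop] fun n : ℕ => Real.log n / Real.log (Real.log n)

/-- `π₊`, the probability at the end of the critical window. -/
def piPlus {r : ℕ} (F : Finset (Finset (Fin r))) (g : ℕ → ℝ) (n : ℕ) : ℝ :=
  ((autCard F : ℝ) / (Nat.factorial r : ℝ)) *
    ((Real.log n + g n) / ((n - 1).choose (r - 1) : ℝ))

/-- `π₋`, the probability at the start of the critical window. -/
def piMinus {r : ℕ} (F : Finset (Finset (Fin r))) (g : ℕ → ℝ) (n : ℕ) : ℝ :=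
  ((autCard F : ℝ) / (Nat.factorial r : ℝ)) *
    ((Real.log n - g n) / ((n - 1).choose (r - 1) : ℝ))

/-- `p₊ = (π₊/(1-n^{-δ}))^{1/s}` where `s = e(F)`. -/
def pPlus {r : ℕ} (F : Finset (Finset (Fin r))) (g : ℕ → ℝ) (δ : ℝ) (n : ℕ) : ℝ :=
  (piPlus F g n / (1 - (n : ℝ) ^ (-δ))) ^ ((1 : ℝ) / (F.card : ℝ))

/-- Connectivity (as a multihypergraph of vertex sets) of a set of `F`-edges. -/
def ConnFE {n : ℕ} (S : Finset (FE n)) : Prop :=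
  ∀ a ∈ S, ∀ b ∈ S,
    Relation.ReflTransGen (fun x y : FE n => x ∈ S ∧ y ∈ S ∧ (x.1 ∩ y.1).Nonempty) a b

/-- The multihypergraph of vertex sets of the `F`-edges of `H` contains an avoidable
configuration: a connected `S ⊆ H` with nullity `(r-1)e(S)+1-v(S) > 1` and
`e(S) ≤ 2^(r+1)`. -/
def HasAvoidable (r : ℕ) {n : ℕ} (H : Finset (FE n)) : Prop :=
  ∃ S ⊆ H, S.Nonempty ∧ ConnFE S ∧
    (S.sup Prod.fst).card < (r - 1) * S.card ∧ S.card ≤ 2 ^ (r + 1)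

/-- `G` contains an `F`-factor: pairwise vertex-disjoint copies of `F`, each a subgraph
of `G`, whose vertex sets partition `[n]`. -/
def HasFFactor {r : ℕ} (F : Finset (Finset (Fin r))) (n : ℕ)
    (G : Finset (Finset (Fin n))) : Prop :=
  ∃ C : Finset (FE n), (∀ h ∈ C, IsFEdge F n h ∧ h.2 ⊆ G) ∧
    (∀ h ∈ C, ∀ h' ∈ C, h ≠ h' → Disjoint h.1 h'.1) ∧
    C.sup Prod.fst = Finset.univ ∧ C.card * r = n

section Structural

variable {r n u : ℕ} {F : Finset (Finset (Fin r))}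

lemma fe_card1 {h : FE n} (hh : IsFEdge F n h) : h.1.card = r := by
  obtain ⟨φ, h1, -⟩ := hh
  rw [h1]; simp

lemma fe_card2 {h : FE n} (hh : IsFEdge F n h) : h.2.card = F.card := by
  obtain ⟨φ, -, h2⟩ := hh
  rw [h2, Finset.card_image_of_injective]
  exact Finset.map_injective φ

lemma fe_sub {h : FE n} (hh : IsFEdge F n h) {e : Finset (Fin n)} (he : e ∈ h.2) : e ⊆ h.1 := by
  obtain ⟨φ, h1, h2⟩ := hh
  rw [h2] at he
  obtain ⟨e', -, rfl⟩ := Finset.mem_image.1 he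
  rw [h1]
  exact Finset.map_subset_map.2 (Finset.subset_univ _)

lemma fe_ecard (hFc : ∀ e ∈ F, e.card = u) {h : FE n} (hh : IsFEdge F n h)
    {e : Finset (Fin n)} (he : e ∈ h.2) : e.card = u := by
  obtain ⟨φ, h1, h2⟩ := hh
  rw [h2] at he
  obtain ⟨e', he', rfl⟩ := Finset.mem_image.1 he
  simp [hFc e' he']

lemma fe_conn (h3 : ThreeConnected F) {h : FE n} (hh : IsFEdge F n h)
    (Z : Finset (Fin n)) (hZ : Z.card ≤ 2) {x y : Fin n} (hx : x ∈ h.1) (hy : y ∈ h.1)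
    (hxZ : x ∉ Z) (hyZ : y ∉ Z) :
    Relation.ReflTransGen (fun a b => ∃ e ∈ h.2, Disjoint e Z ∧ a ∈ e ∧ b ∈ e) x y := by
  obtain ⟨φ, h1, h2⟩ := hh
  rw [h1] at hx hy
  obtain ⟨x', -, rfl⟩ := Finset.mem_map.1 hx
  obtain ⟨y', -, rfl⟩ := Finset.mem_map.1 hy
  have hS : (Finset.univ.filter (fun a => φ a ∈ Z)).card ≤ 2 := by
    refine le_trans ?_ hZ
    refine Finset.card_le_card_of_injOn φ ?_ φ.injective.injOn
    intro a ha
    simpa using ha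
  have := h3.2 _ hS x' y' (by simpa using hxZ) (by simpa using hyZ)
  refine Relation.ReflTransGen.lift φ ?_ _ _ this
  rintro a b ⟨e, he, hd, ha, hb⟩
  refine ⟨e.map φ, ?_, ?_, ?_, ?_⟩
  · rw [h2]; exact Finset.mem_image_of_mem _ he
  · rw [Finset.disjoint_left] at hd ⊢
    intro c hc hcZ
    obtain ⟨c', hc', rfl⟩ := Finset.mem_map.1 hc
    exact hd hc' (by simpa using hcZ)
  · exact Finset.mem_map_of_mem _ ha
  · exact Finset.mem_map_of_mem _ hb

/-- Every vertex of a copy is in an edge of the copy. -/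
lemma fe_cover (hr : 4 ≤ r) (h3 : ThreeConnected F) {h : FE n} (hh : IsFEdge F n h)
    {x : Fin n} (hx : x ∈ h.1) : ∃ e ∈ h.2, x ∈ e := by
  have hc := fe_card1 hh
  obtain ⟨y, hy, hyx⟩ := Finset.exists_mem_ne (by omega : 1 < h.1.card) x
  have := fe_conn h3 hh ∅ (by simp) hx hy (by simp) (by simp)
  rcases Relation.ReflTransGen.cases_head this with h | ⟨c, ⟨e, he, -, hxe, -⟩, -⟩
  · exact absurd h.symm hyx
  · exact ⟨e, he, hxe⟩

lemma fe_cut (h3 : ThreeConnected F) {h : FE n} (hh : IsFEdge F n h)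
    (A B Z : Finset (Fin n)) (hZ : Z.card ≤ 2)
    (hE : ∀ e ∈ h.2, Disjoint e Z → e ⊆ A ∨ e ⊆ B) (hAB : A ∩ B ⊆ Z)
    {x y : Fin n} (hx : x ∈ h.1) (hy : y ∈ h.1) (hxA : x ∈ A) (hyB : y ∈ B)
    (hxZ : x ∉ Z) (hyZ : y ∉ Z) : False := by
  have hp := fe_conn h3 hh Z hZ hx hy hxZ hyZ
  have key : y ∈ A ∧ y ∉ Z := by
    clear hyB hyZ hy
    induction hp with
    | refl => exact ⟨hxA, hxZ⟩
    | tail _ hs ih =>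
      obtain ⟨e, he, hd, ha, hb⟩ := hs
      have hbZ := Finset.disjoint_left.1 hd hb
      refine ⟨?_, hbZ⟩
      rcases hE e he hd with h | h
      · exact h hb
      · exact absurd (hAB (Finset.mem_inter.2 ⟨ih.1, h ha⟩)) ih.2
  exact hyZ (hAB (Finset.mem_inter.2 ⟨key.1, hyB⟩))

lemma connFE_insert {U : Finset (FE n)} (hU : ConnFE U) {h k : FE n} (hk : k ∈ U)
    (hne : (k.1 ∩ h.1).Nonempty) : ConnFE (insert h U) := by
  have mono : ∀ a ∈ U, ∀ b ∈ U, Relation.ReflTransGen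
      (fun x y : FE n => x ∈ insert h U ∧ y ∈ insert h U ∧ (x.1 ∩ y.1).Nonempty) a b := by
    intro a ha b hb
    refine Relation.ReflTransGen.mono ?_ _ _ (hU a ha b hb)
    rintro x y ⟨hx, hy, hxy⟩
    exact ⟨Finset.mem_insert_of_mem hx, Finset.mem_insert_of_mem hy, hxy⟩
  have hkm : k ∈ insert h U := Finset.mem_insert_of_mem hk
  have hhm : h ∈ insert h U := Finset.mem_insert_self _ _
  have s1 : Relation.ReflTransGen
      (fun x y : FE n => x ∈ insert h U ∧ y ∈ insert h U ∧ (x.1 ∩ y.1).Nonempty) k h :=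
    Relation.ReflTransGen.single ⟨hkm, hhm, hne⟩
  have s2 : Relation.ReflTransGen
      (fun x y : FE n => x ∈ insert h U ∧ y ∈ insert h U ∧ (x.1 ∩ y.1).Nonempty) h k :=
    Relation.ReflTransGen.single ⟨hhm, hkm, by rwa [Finset.inter_comm]⟩
  intro a ha b hb
  rcases Finset.mem_insert.1 ha with rfl | ha' <;> rcases Finset.mem_insert.1 hb with rfl | hb'
  · exact Relation.ReflTransGen.refl
  · exact s2.trans (mono _ hk _ hb')
  · exact (mono _ ha' _ hk).trans s1
  · exact mono _ ha' _ hb'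

lemma connFE_erase {S : Finset (FE n)} (hS : ConnFE S) (h2 : 2 ≤ S.card) :
    ∃ h ∈ S, ConnFE (S.erase h) ∧ ∃ k ∈ S.erase h, (h.1 ∩ k.1).Nonempty := by
  obtain ⟨a, ha⟩ := Finset.card_pos.1 (by omega : 0 < S.card)
  let P := S.powerset.filter (fun U => ConnFE U ∧ U.Nonempty ∧ U ≠ S)
  have hP : P.Nonempty := by
    refine ⟨{a}, ?_⟩
    simp only [P, Finset.mem_filter, Finset.mem_powerset, Finset.singleton_subset_iff]
    refine ⟨ha, ?_, Finset.singleton_nonempty a, ?_⟩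
    · intro x hx y hy
      rw [Finset.mem_singleton] at hx hy
      subst hx; subst hy; exact Relation.ReflTransGen.refl
    · rintro rfl; simp at h2
  obtain ⟨U, hUP, hmax⟩ := Finset.exists_max_image P Finset.card hP
  simp only [P, Finset.mem_filter, Finset.mem_powerset] at hUP
  obtain ⟨hUS, hUc, hUn, hUne⟩ := hUP
  obtain ⟨k, hkU⟩ := hUn
  obtain ⟨m, hmS, hmU⟩ := Finset.exists_of_ssubset (hUS.ssubset_of_ne hUne)
  have key : ∀ m, Relation.ReflTransGen
      (fun x y : FE n => x ∈ S ∧ y ∈ S ∧ (x.1 ∩ y.1).Nonempty) k m → m ∉ U →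
      ∃ k ∈ U, ∃ m ∈ S, m ∉ U ∧ (k.1 ∩ m.1).Nonempty := by
    intro m hm
    induction hm with
    | refl => intro h; exact absurd hkU h
    | @tail b c _ hs ih =>
      intro hc
      by_cases hb : b ∈ U
      · exact ⟨b, hb, c, hs.2.1, hc, hs.2.2⟩
      · exact ih hb
  obtain ⟨k', hk', m', hm'S, hm'U, hne⟩ := key m (hS k (hUS hkU) m hmS) hmU
  have hci := connFE_insert hUc hk' hne
  have heq : insert m' U = S := by
    by_contra hneq
    have := hmax (insert m' U) (by
      simp only [P, Finset.mem_filter, Finset.mem_powerset]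
      exact ⟨Finset.insert_subset hm'S hUS, hci, Finset.insert_nonempty _ _, hneq⟩)
    rw [Finset.card_insert_of_notMem hm'U] at this
    omega
  refine ⟨m', hm'S, ?_, k', ?_, by rwa [Finset.inter_comm]⟩
  · rw [← heq, Finset.erase_insert hm'U]; exact hUc
  · rw [← heq, Finset.erase_insert hm'U]; exact hk'

lemma sup_erase {S : Finset (FE n)} {h : FE n} (hh : h ∈ S) :
    S.sup Prod.fst = h.1 ∪ (S.erase h).sup Prod.fst := by
  conv_lhs => rw [← Finset.insert_erase hh]
  rw [Finset.sup_insert]; rfl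

lemma connFE_card_le : ∀ (k : ℕ) (S : Finset (FE n)), S.card = k + 1 → ConnFE S →
    (∀ h ∈ S, h.1.card = r) → (S.sup Prod.fst).card + k ≤ r * (k + 1)  := by
  intro k
  induction k with
  | zero =>
    intro S hS _ hc
    obtain ⟨a, rfl⟩ := Finset.card_eq_one.1 hS
    simp [hc]
  | succ k ih =>
    intro S hS hconn hc
    obtain ⟨h, hhS, hconn', k', hk', hne⟩ := connFE_erase hconn (by omega)
    have h1 := ih (S.erase h) (by rw [Finset.card_erase_of_mem hhS]; omega) hconn'
      (fun x hx => hc x (Finset.mem_of_mem_erase hx))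
    rw [sup_erase hhS]
    have h2 := Finset.card_union_add_card_inter h.1 ((S.erase h).sup Prod.fst)
    have h3 : 0 < (h.1 ∩ (S.erase h).sup Prod.fst).card := by
      obtain ⟨x, hx⟩ := hne
      refine Finset.card_pos.2 ⟨x, ?_⟩
      rw [Finset.mem_inter] at hx ⊢
      exact ⟨hx.1, Finset.le_sup (f := Prod.fst) hk' hx.2⟩
    have h4 := hc h hhS
    rw [Nat.mul_succ]
    omega

/-- A copy on the same vertex set which differs in one edge contradicts niceness. -/
lemma fe_swap (hno : ¬ ∃ a b : Finset (Fin r), a.card = u ∧ a ∉ F ∧ b ∈ F ∧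
      EdgeIso (insert a (F.erase b)) F)
    {h t : FE n} (hh : IsFEdge F n h) (ht : IsFEdge F n t) (hV : h.1 = t.1)
    {e : Finset (Fin n)} (heu : e.card = u) (heh : e ∈ h.2) (het : e ∉ t.2)
    (hsub : ∀ e' ∈ h.2, e' ≠ e → e' ∈ t.2) : False := by
  have hcard : h.2.card = t.2.card := by rw [fe_card2 hh, fe_card2 ht]
  have hsub' : h.2.erase e ⊆ t.2 := by
    intro e' he'
    exact hsub e' (Finset.mem_of_mem_erase he') (Finset.ne_of_mem_erase he')
  have hpos : 0 < h.2.card := Finset.card_pos.2 ⟨e, heh⟩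
  have hone : (t.2 \ h.2.erase e).card = 1 := by
    rw [Finset.card_sdiff_of_subset hsub', Finset.card_erase_of_mem heh]; omega
  obtain ⟨b, hb⟩ := Finset.card_eq_one.1 hone
  have hbt : b ∈ t.2 := (Finset.mem_sdiff.1 (hb ▸ Finset.mem_singleton_self b)).1
  have hterase : t.2.erase b = h.2.erase e := by
    have : t.2 \ {b} = h.2.erase e := by
      rw [← hb, Finset.sdiff_sdiff_eq_self hsub']
    rw [← this, Finset.sdiff_singleton_eq_erase]
  have hee : e ⊆ t.1 := hV ▸ fe_sub hh heh
  obtain ⟨φ, h1, h2⟩ := hh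
  obtain ⟨ψ, t1, t2⟩ := ht
  rw [t2] at hbt
  obtain ⟨b', hb', rfl⟩ := Finset.mem_image.1 hbt
  obtain ⟨a, ha⟩ : ∃ a : Finset (Fin r), a.map ψ = e := by
    rw [t1] at hee
    obtain ⟨a, -, ha⟩ := Finset.subset_map_iff.1 hee
    exact ⟨a, ha.symm⟩
  -- the permutation
  have hex : ∀ x : Fin r, ∃ y : Fin r, φ y = ψ x := by
    intro x
    have : ψ x ∈ h.1 := by rw [hV, t1]; simp
    rw [h1] at this
    simpa using this
  choose σ hσ using hex
  have hinj : Function.Injective σ := by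
    intro x y hxy
    apply ψ.injective
    rw [← hσ, ← hσ, hxy]
  let σ' : Equiv.Perm (Fin r) := Equiv.ofBijective σ (Finite.injective_iff_bijective.1 hinj)
  refine hno ⟨a, b', ?_, ?_, hb', σ', ?_⟩
  · rw [← heu, ← ha]; simp
  · intro haF
    apply het
    rw [t2, ← ha]
    exact Finset.mem_image_of_mem _ haF
  · have hmap : ∀ c : Finset (Fin r), (c.image (fun x => σ' x)).map φ = c.map ψ := by
      intro c
      ext x
      simp only [Finset.mem_map, Finset.mem_image]
      constructor
      · rintro ⟨_, ⟨z, hz, rfl⟩, rfl⟩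
        exact ⟨z, hz, (hσ z).symm⟩
      · rintro ⟨z, hz, rfl⟩
        exact ⟨_, ⟨z, hz, rfl⟩, hσ z⟩
    have hinjm : Function.Injective (fun c : Finset (Fin r) => c.map φ) := Finset.map_injective φ
    apply Finset.image_injective hinjm
    rw [Finset.image_image]
    have : ((fun c : Finset (Fin r) => c.map φ) ∘ fun e => e.image (fun x => σ' x))
        = fun c : Finset (Fin r) => c.map ψ := by
      funext c; exact hmap c
    rw [this, ← h2, Finset.image_insert, Finset.image_erase (Finset.map_injective ψ), ← t2, ha,
      hterase, Finset.insert_erase heh]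

end Structural
section Structural2

variable {r n u : ℕ} {F : Finset (Finset (Fin r))}

lemma edges_card_le (F : Finset (Finset (Fin r))) : F.card ≤ 2 ^ r := by
  have := Finset.card_le_univ F
  simpa using this

lemma cover_conn (hu : 2 ≤ u) (hFc : ∀ e ∈ F, e.card = u) (h3 : ThreeConnected F)
    {h : FE n} (hh : IsFEdge F n h) {T : Finset (FE n)} (hT : ∀ t ∈ T, IsFEdge F n t)
    (hcov : ∀ e ∈ h.2, ∃ t ∈ T, e ∈ t.2)
    (hpriv : ∀ t ∈ T, ∃ e ∈ h.2, e ∈ t.2) : ConnFE T := by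
  intro a ha b hb
  obtain ⟨ea, heah, hea⟩ := hpriv a ha
  obtain ⟨eb, hebh, heb⟩ := hpriv b hb
  obtain ⟨x, hx⟩ := Finset.card_pos.1 (by rw [fe_ecard hFc hh heah]; omega : 0 < ea.card)
  obtain ⟨y, hy⟩ := Finset.card_pos.1 (by rw [fe_ecard hFc hh hebh]; omega : 0 < eb.card)
  have hp := fe_conn h3 hh ∅ (by simp) (fe_sub hh heah hx) (fe_sub hh hebh hy)
    (by simp) (by simp)
  have key : ∀ y, Relation.ReflTransGen
      (fun a b => ∃ e ∈ h.2, Disjoint e (∅ : Finset (Fin n)) ∧ a ∈ e ∧ b ∈ e) x y →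
      ∀ t ∈ T, y ∈ t.1 → Relation.ReflTransGen
        (fun x y : FE n => x ∈ T ∧ y ∈ T ∧ (x.1 ∩ y.1).Nonempty) a t := by
    intro y hy
    induction hy with
    | refl =>
      intro t ht hxt
      exact Relation.ReflTransGen.single
        ⟨ha, ht, x, Finset.mem_inter.2 ⟨fe_sub (hT a ha) hea hx, hxt⟩⟩
    | @tail b c _ hs ih =>
      intro t ht hct
      obtain ⟨e, he, -, hbe, hce⟩ := hs
      obtain ⟨t', ht', het'⟩ := hcov e he
      refine (ih t' ht' (fe_sub (hT t' ht') het' hbe)).tail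
        ⟨ht', ht, c, Finset.mem_inter.2 ⟨fe_sub (hT t' ht') het' hce, hct⟩⟩
  exact key y hp b hb (fe_sub (hT b hb) heb hy)

lemma exists_min_cover {h : FE n} {H : Finset (FE n)} (hsub : h.2 ⊆ H.sup Prod.snd) :
    ∃ T ⊆ H, T.card ≤ h.2.card ∧ (∀ e ∈ h.2, ∃ t ∈ T, e ∈ t.2) ∧
      ∀ t ∈ T, ∃ e ∈ h.2, e ∈ t.2 ∧ ∀ t' ∈ T, e ∈ t'.2 → t' = t := by
  have hc : ∀ e : Finset (Fin n), ∃ t : FE n, e ∈ h.2 → t ∈ H ∧ e ∈ t.2 := by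
    intro e
    by_cases he : e ∈ h.2
    · obtain ⟨t, ht, het⟩ := Finset.mem_sup.1 (hsub he)
      exact ⟨t, fun _ => ⟨ht, het⟩⟩
    · exact ⟨h, fun h => absurd h he⟩
  choose f hf using hc
  let P := H.powerset.filter (fun T => ∀ e ∈ h.2, ∃ t ∈ T, e ∈ t.2)
  have h0 : h.2.image f ∈ P := by
    simp only [P, Finset.mem_filter, Finset.mem_powerset]
    refine ⟨?_, fun e he => ⟨f e, Finset.mem_image_of_mem _ he, (hf e he).2⟩⟩
    intro t ht
    obtain ⟨e, he, rfl⟩ := Finset.mem_image.1 ht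
    exact (hf e he).1
  obtain ⟨T, hTP, hmin⟩ := Finset.exists_min_image P Finset.card ⟨_, h0⟩
  have hle := (hmin _ h0).trans Finset.card_image_le
  simp only [P, Finset.mem_filter, Finset.mem_powerset] at hTP
  refine ⟨T, hTP.1, hle, hTP.2, ?_⟩
  intro t ht
  by_contra hcon
  push Not at hcon
  have : T.erase t ∈ P := by
    simp only [P, Finset.mem_filter, Finset.mem_powerset]
    refine ⟨(Finset.erase_subset _ _).trans hTP.1, fun e he => ?_⟩
    obtain ⟨t', ht', het'⟩ := hTP.2 e he
    by_cases htt : t' = t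
    · subst htt
      obtain ⟨t'', ht'', he'', hne⟩ := hcon e he het'
      exact ⟨t'', Finset.mem_erase.2 ⟨hne, ht''⟩, he''⟩
    · exact ⟨t', Finset.mem_erase.2 ⟨htt, ht'⟩, het'⟩
  have := hmin _ this
  rw [Finset.card_erase_of_mem ht] at this
  have := Finset.card_pos.2 ⟨t, ht⟩
  omega

/-- In an `F`-graph without avoidable configurations, each copy of `F` in the union
is one of the given copies. -/
lemma no_extra (hu : 2 ≤ u) (hr : 4 ≤ r) (hFc : ∀ e ∈ F, e.card = u) (hF : Nice u F)
    {H : Finset (FE n)} (hH : ∀ t ∈ H, IsFEdge F n t) (hav : ¬ HasAvoidable r H)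
    {h : FE n} (hh : IsFEdge F n h) (hsub : h.2 ⊆ H.sup Prod.snd) : h ∈ H := by
  obtain ⟨-, h3, hnice⟩ := hF
  obtain ⟨T, hTH, hTc, hcov, hpriv⟩ := exists_min_cover hsub
  have hT : ∀ t ∈ T, IsFEdge F n t := fun t ht => hH t (hTH ht)
  have hconn : ConnFE T := cover_conn hu hFc h3 hh hT hcov
    (fun t ht => by obtain ⟨e, he, he', -⟩ := hpriv t ht; exact ⟨e, he, he'⟩)
  have hhc := fe_card1 hh
  obtain ⟨x0, hx0⟩ := Finset.card_pos.1 (by omega : 0 < h.1.card)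
  obtain ⟨e0, he0, -⟩ := fe_cover hr h3 hh hx0
  obtain ⟨t0, ht0, -⟩ := hcov e0 he0
  have hTle : T.card ≤ 2 ^ (r + 1) := by
    have h1 := fe_card2 hh
    have h2 := edges_card_le F
    rw [pow_succ]
    omega
  have hVT : (r - 1) * T.card ≤ (T.sup Prod.fst).card := by
    by_contra hlt
    exact hav ⟨T, hTH, ⟨t0, ht0⟩, hconn, by omega, hTle⟩
  have hTpos : 0 < T.card := Finset.card_pos.2 ⟨t0, ht0⟩
  -- the case of a single covering copy
  rcases Nat.lt_or_ge T.card 2 with hT1 | hT2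
  · obtain ⟨t, rfl⟩ := Finset.card_eq_one.1 (by omega : T.card = 1)
    have htH : t ∈ H := hTH (by simp)
    have ht := hH t htH
    have h2 : h.2 = t.2 := by
      apply Finset.eq_of_subset_of_card_le
      · intro e he
        obtain ⟨t', ht', he'⟩ := hcov e he
        rw [Finset.mem_singleton] at ht'
        exact ht' ▸ he'
      · rw [fe_card2 hh, fe_card2 ht]
    have h1 : h.1 = t.1 := by
      apply Finset.eq_of_subset_of_card_le
      · intro x hx
        obtain ⟨e, he, hxe⟩ := fe_cover hr h3 hh hx
        rw [h2] at he
        exact fe_sub ht he hxe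
      · rw [fe_card1 hh, fe_card1 ht]
    have : h = t := Prod.ext h1 h2
    rwa [this]
  exfalso
  obtain ⟨h₁, h1T, hconn1, -⟩ := connFE_erase hconn hT2
  set T' := T.erase h₁ with hT'
  have hT'c : T'.card + 1 = T.card := Finset.card_erase_add_one h1T
  have hT'sub : ∀ t ∈ T', t ∈ T := fun t ht => Finset.mem_of_mem_erase ht
  have hT'ne : ∀ t ∈ T', t ≠ h₁ := fun t ht => Finset.ne_of_mem_erase ht
  have hc1 : h₁.1.card = r := fe_card1 (hT _ h1T)
  set A := h₁.1 with hA
  set B := T'.sup Prod.fst with hB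
  have hsubB : ∀ t ∈ T', t.1 ⊆ B := fun t ht => Finset.le_sup (f := Prod.fst) ht
  have hBle := connFE_card_le (r := r) (T'.card - 1) T' (by omega) hconn1
    (fun t ht => fe_card1 (hT t (hT'sub t ht)))
  have hui := Finset.card_union_add_card_inter A B
  rw [sup_erase h1T, ← hA, ← hT', ← hB] at hVT
  obtain ⟨m, hm⟩ : ∃ m, T'.card = m + 1 := ⟨T'.card - 1, by omega⟩
  obtain ⟨q, rfl⟩ : ∃ q, r = q + 1 := ⟨r - 1, by omega⟩
  have hTm : T.card = m + 2 := by omega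
  rw [hm] at hBle
  rw [hTm] at hVT
  simp only [Nat.add_sub_cancel] at hVT hBle
  rw [← hB] at hBle
  have hZ : (A ∩ B).card ≤ 2 := by nlinarith
  have hedge : ∀ e ∈ h.2, e ⊆ A ∨ e ⊆ B := by
    intro e he
    obtain ⟨t, ht, het⟩ := hcov e he
    by_cases htt : t = h₁
    · left; subst htt; exact fe_sub (hT _ ht) het
    · right
      exact (fe_sub (hT _ ht) het).trans (hsubB t (Finset.mem_erase.2 ⟨htt, ht⟩))
  obtain ⟨t1, ht1⟩ := Finset.card_pos.1 (by omega : 0 < T'.card)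
  obtain ⟨e₁, he1h, he1, he1p⟩ := hpriv h₁ h1T
  obtain ⟨e₂, he2h, he2, he2p⟩ := hpriv t1 (hT'sub _ ht1)
  have he1A : e₁ ⊆ A := fe_sub (hT _ h1T) he1
  have he2B : e₂ ⊆ B := (fe_sub (hT _ (hT'sub _ ht1)) he2).trans (hsubB _ ht1)
  have hu1 := fe_ecard hFc hh he1h
  have hu2 := fe_ecard hFc hh he2h
  have hdich : h.1 ∩ A ⊆ A ∩ B ∨ h.1 ∩ B ⊆ A ∩ B := by
    by_contra hcon
    push Not at hcon
    obtain ⟨⟨x, hx, hxZ⟩, ⟨y, hy, hyZ⟩⟩ := And.imp Finset.not_subset.1 Finset.not_subset.1 hcon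
    rw [Finset.mem_inter] at hx hy
    exact fe_cut h3 hh A B (A ∩ B) hZ (fun e he _ => hedge e he) (Finset.Subset.refl _)
      hx.1 hy.1 hx.2 hy.2 hxZ hyZ
  -- the case `u ≥ 3` is immediate
  rcases hnice with hu3 | ⟨hu2', hno⟩
  · rcases hdich with hd | hd
    · have := Finset.card_le_card
        ((Finset.subset_inter (fe_sub hh he1h) he1A).trans hd)
      omega
    · have := Finset.card_le_card
        ((Finset.subset_inter (fe_sub hh he2h) he2B).trans hd)
      omega
  have hcovV : ∀ x ∈ h.1, x ∈ A ∨ x ∈ B := by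
    intro x hx
    obtain ⟨e, he, hxe⟩ := fe_cover hr h3 hh hx
    rcases hedge e he with h | h
    · exact Or.inl (h hxe)
    · exact Or.inr (h hxe)
  rcases hdich with hd | hd
  · -- only the edge `A ∩ B` of the copy is in `h₁`
    have hZe : e₁ = A ∩ B := Finset.eq_of_subset_of_card_le
      ((Finset.subset_inter (fe_sub hh he1h) he1A).trans hd) (by omega)
    have hVB : h.1 ⊆ B := by
      intro x hx
      rcases hcovV x hx with h | h
      · exact (Finset.mem_inter.1 (hd (Finset.mem_inter.2 ⟨hx, h⟩))).2
      · exact h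
    have hoth : ∀ e ∈ h.2, e ≠ e₁ → ∃ t ∈ T', e ∈ t.2 := by
      intro e he hne
      obtain ⟨t, ht, het⟩ := hcov e he
      refine ⟨t, Finset.mem_erase.2 ⟨?_, ht⟩, het⟩
      rintro rfl
      apply hne
      rw [hZe]
      exact Finset.eq_of_subset_of_card_le
        ((Finset.subset_inter (fe_sub hh he) (fe_sub (hT _ ht) het)).trans hd)
        (by rw [fe_ecard hFc hh he]; omega)
    rcases Nat.eq_zero_or_pos m with hm0 | hmpos
    · obtain ⟨t, htT⟩ := Finset.card_eq_one.1 (by omega : T'.card = 1)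
      have ht : t ∈ T' := by rw [htT]; simp
      have hBt : B = t.1 := by rw [hB, htT]; simp
      have hft := hT t (hT'sub _ ht)
      refine fe_swap hno hh hft ?_ hu1 he1h ?_ ?_
      · exact Finset.eq_of_subset_of_card_le (hBt ▸ hVB) (by rw [fe_card1 hh, fe_card1 hft])
      · intro hc
        exact hT'ne t ht (he1p t (hT'sub _ ht) hc)
      · intro e he hne
        obtain ⟨t', ht', het'⟩ := hoth e he hne
        rw [htT, Finset.mem_singleton] at ht'
        exact ht' ▸ het'
    · obtain ⟨h₂, h2T, hconn2, -⟩ := connFE_erase hconn1 (by omega)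
      set T'' := T'.erase h₂ with hT''
      have hT''c : T''.card + 1 = T'.card := Finset.card_erase_add_one h2T
      have hT''sub : ∀ t ∈ T'', t ∈ T' := fun t ht => Finset.mem_of_mem_erase ht
      have hc2 : h₂.1.card = q + 1 := fe_card1 (hT _ (hT'sub _ h2T))
      set A' := h₂.1 with hA'
      set B' := T''.sup Prod.fst with hB'
      have hsubB' : ∀ t ∈ T'', t.1 ⊆ B' := fun t ht => Finset.le_sup (f := Prod.fst) ht
      have hBle' := connFE_card_le (r := q + 1) (T''.card - 1) T'' (by omega) hconn2
        (fun t ht => fe_card1 (hT t (hT'sub t (hT''sub t ht))))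
      have hui' := Finset.card_union_add_card_inter A' B'
      have hBun : B = A' ∪ B' := sup_erase h2T
      obtain ⟨l, rfl⟩ : ∃ l, m = l + 1 := ⟨m - 1, by omega⟩
      rw [show T''.card = l + 1 by omega, ← hB'] at hBle'
      simp only [Nat.add_sub_cancel] at hBle'
      have hABc : (A ∩ B).card = 2 := by rw [← hZe, hu1, hu2']
      rw [← hBun] at hui'
      have hD : (A' ∩ B').card ≤ 1 := by nlinarith
      obtain ⟨t2, ht2⟩ := Finset.card_pos.1 (by omega : 0 < T''.card)
      obtain ⟨f₁, hf1h, hf1, -⟩ := hpriv h₂ (hT'sub _ h2T)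
      obtain ⟨f₂, hf2h, hf2, -⟩ := hpriv t2 (hT'sub _ (hT''sub _ ht2))
      have hf1A : f₁ ⊆ A' := fe_sub (hT _ (hT'sub _ h2T)) hf1
      have hf2B : f₂ ⊆ B' :=
        (fe_sub (hT _ (hT'sub _ (hT''sub _ ht2))) hf2).trans (hsubB' _ ht2)
      have hcf1 := fe_ecard hFc hh hf1h
      have hcf2 := fe_ecard hFc hh hf2h
      set D := A' ∩ B' with hDdef
      obtain ⟨p₁, hp1, hp1D⟩ : ∃ x ∈ f₁, x ∉ D := by
        by_contra hcon
        push Not at hcon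
        have := Finset.card_le_card (show f₁ ⊆ D from hcon)
        omega
      obtain ⟨p₂, hp2, hp2D⟩ : ∃ x ∈ f₂, x ∉ D := by
        by_contra hcon
        push Not at hcon
        have := Finset.card_le_card (show f₂ ⊆ D from hcon)
        omega
      obtain ⟨x, y, hxy, hexy⟩ := Finset.card_eq_two.1 (hu1.trans hu2')
      have hsplit : ∀ w ∈ e₁, (∀ a ∈ h.1, a ∈ A' → a ∉ D → a = w) ∨
          (∀ b ∈ h.1, b ∈ B' → b ∉ D → b = w) := by
        intro w hw
        by_contra hcon
        push Not at hcon
        obtain ⟨⟨a, ha, haA, haD, haw⟩, ⟨b, hb, hbB, hbD, hbw⟩⟩ := hcon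
        refine fe_cut h3 hh A' B' (insert w D) ?_ ?_ ?_ ha hb haA hbB ?_ ?_
        · exact (Finset.card_insert_le _ _).trans (by omega)
        · intro e he hdis
          have hne : e ≠ e₁ := by
            rintro rfl
            exact Finset.disjoint_left.1 hdis hw (Finset.mem_insert_self _ _)
          obtain ⟨t, ht, het⟩ := hoth e he hne
          by_cases htt : t = h₂
          · left; subst htt; exact fe_sub (hT _ (hT'sub _ ht)) het
          · right
            exact (fe_sub (hT _ (hT'sub _ ht)) het).trans
              (hsubB' t (Finset.mem_erase.2 ⟨htt, ht⟩))
        · exact Finset.subset_insert _ _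
        · simp [haw, haD]
        · simp [hbw, hbD]
      have hall : h.1 ⊆ insert x (insert y D) := by
        intro z hz
        have hzAB : z ∈ A' ∨ z ∈ B' := by
          have := hVB hz
          rw [hBun] at this
          exact Finset.mem_union.1 this
        by_cases hzD : z ∈ D
        · simp [hzD]
        · have hp1' := fe_sub hh hf1h hp1
          have hp2' := fe_sub hh hf2h hp2
          rcases hsplit x (by simp [hexy]) with hx | hx <;>
          rcases hsplit y (by simp [hexy]) with hy | hy
          · exact absurd ((hx p₁ hp1' (hf1A hp1) hp1D).symm.trans
              (hy p₁ hp1' (hf1A hp1) hp1D)) hxy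
          · rcases hzAB with h | h
            · simp [hx z hz h hzD]
            · simp [hy z hz h hzD]
          · rcases hzAB with h | h
            · simp [hy z hz h hzD]
            · simp [hx z hz h hzD]
          · exact absurd ((hx p₂ hp2' (hf2B hp2) hp2D).symm.trans
              (hy p₂ hp2' (hf2B hp2) hp2D)) hxy
      have h5 := Finset.card_le_card hall
      have h6 := Finset.card_insert_le x (insert y D)
      have h7 := Finset.card_insert_le y D
      omega
  · have hZe : e₂ = A ∩ B := Finset.eq_of_subset_of_card_le
      ((Finset.subset_inter (fe_sub hh he2h) he2B).trans hd) (by omega)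
    refine fe_swap hno hh (hT h₁ h1T) ?_ hu2 he2h ?_ ?_
    · apply Finset.eq_of_subset_of_card_le
      · intro x hx
        rcases hcovV x hx with h | h
        · exact h
        · exact (Finset.mem_inter.1 (hd (Finset.mem_inter.2 ⟨hx, h⟩))).1
      · rw [fe_card1 hh, hc1]
    · intro hc
      exact hT'ne t1 ht1 (he2p h₁ h1T hc).symm
    · intro e he hne
      obtain ⟨t, ht, het⟩ := hcov e he
      by_cases htt : t = h₁
      · exact htt ▸ het
      · exfalso
        apply hne
        rw [hZe]
        exact Finset.eq_of_subset_of_card_le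
          ((Finset.subset_inter (fe_sub hh he) ((fe_sub (hT _ ht) het).trans
            (hsubB t (Finset.mem_erase.2 ⟨htt, ht⟩)))).trans hd)
          (by rw [fe_ecard hFc hh he]; omega)

end Structural2
section Counting

variable {r n u : ℕ} {F : Finset (Finset (Fin r))}

/-- The 2-section of a hypergraph on `Fin r`. -/
def secGraph (E : Finset (Finset (Fin r))) : SimpleGraph (Fin r) where
  Adj a b := a ≠ b ∧ ∃ e ∈ E, a ∈ e ∧ b ∈ e
  symm := ⟨by
    rintro a b ⟨h, e, he, ha, hb⟩
    exact ⟨h.symm, e, he, hb, ha⟩⟩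
  loopless := ⟨by
    rintro a ⟨h, -⟩
    exact h rfl⟩

/-- The number of components of a hypergraph on `Fin r`. -/
def ncomp (E : Finset (Finset (Fin r))) : ℕ := Fintype.card (secGraph E).ConnectedComponent

lemma rank_bound (hu : 2 ≤ u) (hFc : ∀ e ∈ F, e.card = u) (hb : StrictlyOneBalanced F)
    {E : Finset (Finset (Fin r))} (hE : E ⊆ F) (hne : E.Nonempty) (hEF : E ≠ F) :
    E.card * (r - 1) + 1 + F.card * ncomp E ≤ F.card * r := by
  let G := secGraph E
  let V : G.ConnectedComponent → Finset (Fin r) := fun c =>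
    Finset.univ.filter (fun a => G.connectedComponentMk a = c)
  let W : G.ConnectedComponent → Finset (Finset (Fin r)) := fun c => E.filter (fun e => e ⊆ V c)
  have hVpos : ∀ c, 1 ≤ (V c).card := by
    intro c
    obtain ⟨a, ha⟩ := c.exists_rep
    refine Finset.card_pos.2 ⟨a, ?_⟩
    simp only [V, Finset.mem_filter, Finset.mem_univ, true_and]
    exact ha
  have hin : ∀ e ∈ E, ∀ a ∈ e, e ⊆ V (G.connectedComponentMk a) := by
    intro e he a ha b hb
    simp only [V, Finset.mem_filter, Finset.mem_univ, true_and]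
    by_cases hab : a = b
    · rw [hab]
    · apply SimpleGraph.ConnectedComponent.sound
      exact SimpleGraph.Adj.reachable (show G.Adj b a from ⟨Ne.symm hab, e, he, hb, ha⟩)
  have hloc : ∀ c, (W c).card * (r - 1) + (if 1 < (V c).card then 1 else 0) + F.card ≤
      F.card * (V c).card := by
    intro c
    have hp := hVpos c
    by_cases h1 : 1 < (V c).card
    · rw [if_pos h1]
      have := hb (V c) (W c) ((Finset.filter_subset _ _).trans hE)
        (fun e he => (Finset.mem_filter.1 he).2) h1 (by
          rintro ⟨-, hw⟩
          exact hEF (Finset.Subset.antisymm hE (hw ▸ Finset.filter_subset _ _)))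
      obtain ⟨k, hk⟩ : ∃ k, (V c).card = k + 1 := ⟨(V c).card - 1, by omega⟩
      rw [hk] at this ⊢
      simp only [Nat.add_sub_cancel] at this
      rw [Nat.mul_succ]
      omega
    · rw [if_neg h1]
      have h1' : (V c).card = 1 := by omega
      have : W c = ∅ := by
        rw [Finset.eq_empty_iff_forall_notMem]
        intro e he
        have h2 := Finset.mem_filter.1 he
        have h3 := Finset.card_le_card h2.2
        have h4 := hFc e (hE h2.1)
        omega
      rw [this, h1']
      simp
  have hsum := Finset.sum_le_sum (fun c (_ : c ∈ (Finset.univ : Finset G.ConnectedComponent)) =>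
    hloc c)
  rw [Finset.sum_add_distrib, Finset.sum_add_distrib, ← Finset.sum_mul, ← Finset.mul_sum] at hsum
  have hVr : ∑ c, (V c).card = r := by
    have := Finset.card_eq_sum_card_fiberwise (s := (Finset.univ : Finset (Fin r)))
      (t := (Finset.univ : Finset G.ConnectedComponent)) (f := G.connectedComponentMk)
      (by intro x _; simp)
    simpa using this.symm
  have hWE : E.card ≤ ∑ c, (W c).card := by
    have : E ⊆ Finset.univ.biUnion W := by
      intro e he
      obtain ⟨a, ha⟩ := Finset.card_pos.1 (by rw [hFc e (hE he)]; omega : 0 < e.card)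
      rw [Finset.mem_biUnion]
      exact ⟨G.connectedComponentMk a, Finset.mem_univ _,
        Finset.mem_filter.2 ⟨he, hin e he a ha⟩⟩
    exact (Finset.card_le_card this).trans Finset.card_biUnion_le
  have hone : 1 ≤ ∑ c, (if 1 < (V c).card then 1 else 0) := by
    obtain ⟨e, he⟩ := hne
    obtain ⟨a, ha⟩ := Finset.card_pos.1 (by rw [hFc e (hE he)]; omega : 0 < e.card)
    have h1 := Finset.card_le_card (hin e he a ha)
    rw [hFc e (hE he)] at h1
    refine le_trans ?_ (Finset.single_le_sum (f := fun c => if 1 < (V c).card then 1 else 0)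
      (fun _ _ => Nat.zero_le _) (Finset.mem_univ (G.connectedComponentMk a)))
    rw [if_pos (by omega)]
  have hcc : ∑ c : G.ConnectedComponent, F.card = F.card * ncomp E := by
    rw [Finset.sum_const, smul_eq_mul, mul_comm]
    rfl
  rw [hVr, hcc] at hsum
  have := Nat.mul_le_mul_right (r - 1) hWE
  omega

/-- Closed neighbourhood of a vertex in an `F`-graph. -/
def nbr (H : Finset (FE n)) (y : Fin n) : Finset (Fin n) :=
  insert y ((H.filter (fun h => y ∈ h.1)).biUnion Prod.fst)

def ball (H : Finset (FE n)) (x : Fin n) : ℕ → Finset (Fin n)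
  | 0 => {x}
  | k + 1 => (ball H x k).biUnion (nbr H)

lemma ball_card (H : Finset (FE n)) (D : ℕ) (hD : ∀ y, (nbr H y).card ≤ D) (x : Fin n) (k : ℕ) :
    (ball H x k).card ≤ D ^ k := by
  induction k with
  | zero => simp [ball]
  | succ k ih =>
    rw [ball, pow_succ]
    exact (Finset.card_biUnion_le_card_mul _ _ D (fun y _ => hD y)).trans
      (Nat.mul_le_mul_right _ ih)

lemma ball_mono (H : Finset (FE n)) (x : Fin n) {k l : ℕ} (hkl : k ≤ l) :
    ball H x k ⊆ ball H x l := by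
  induction hkl with
  | refl => exact Finset.Subset.refl _
  | step _ ih =>
    refine ih.trans ?_
    intro y hy
    rw [ball, Finset.mem_biUnion]
    exact ⟨y, hy, Finset.mem_insert_self _ _⟩

lemma walk_ball (H : Finset (FE n)) (E : Finset (Finset (Fin r))) (φ : Fin r → Fin n)
    (hφ : ∀ e ∈ E, ∃ h ∈ H, ∀ a ∈ e, φ a ∈ h.1) {a b : Fin r} (p : (secGraph E).Walk a b) :
    φ a ∈ ball H (φ b) p.length := by
  induction p with
  | nil => simp [ball]
  | @cons a b c hadj p ih =>
    rw [SimpleGraph.Walk.length_cons, ball, Finset.mem_biUnion]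
    refine ⟨_, ih, ?_⟩
    obtain ⟨-, e, he, ha, hb⟩ := hadj
    obtain ⟨h, hh, hin⟩ := hφ e he
    refine Finset.mem_insert_of_mem (Finset.mem_biUnion.2 ⟨h, ?_, hin a ha⟩)
    exact Finset.mem_filter.2 ⟨hh, hin b hb⟩

lemma reach_ball (H : Finset (FE n)) (E : Finset (Finset (Fin r))) (φ : Fin r → Fin n)
    (hφ : ∀ e ∈ E, ∃ h ∈ H, ∀ a ∈ e, φ a ∈ h.1) {a b : Fin r}
    (hab : (secGraph E).Reachable a b) : φ a ∈ ball H (φ b) r := by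
  obtain ⟨p⟩ := hab
  have hl := p.toPath.2.length_lt
  rw [Fintype.card_fin] at hl
  exact ball_mono H _ hl.le (walk_ball H E φ hφ _)

lemma count_bound (H : Finset (FE n)) (D : ℕ) (hD : ∀ y, (nbr H y).card ≤ D)
    (E : Finset (Finset (Fin r))) (i : Fin r) (v : Fin n) :
    ((Finset.univ : Finset (Fin r → Fin n)).filter (fun φ => φ i = v ∧
      ∀ e ∈ E, ∃ h ∈ H, ∀ a ∈ e, φ a ∈ h.1)).card ≤ (D ^ r) ^ (r + 1) * n ^ (ncomp E - 1) := by
  let G := secGraph E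
  let c0 := G.connectedComponentMk i
  let X : Finset (G.ConnectedComponent → Fin n) :=
    Fintype.piFinset (fun c => if c = c0 then ball H v r else Finset.univ)
  have hX : X.card ≤ D ^ r * n ^ (ncomp E - 1) := by
    rw [Fintype.card_piFinset, ← Finset.mul_prod_erase _ _ (Finset.mem_univ c0), if_pos rfl]
    refine Nat.mul_le_mul (ball_card H D hD v r) ?_
    rw [Finset.prod_congr rfl (g := fun _ => n)]
    · rw [Finset.prod_const, Finset.card_erase_of_mem (Finset.mem_univ _), Finset.card_univ]
      exact le_refl _
    · intro c hc
      rw [if_neg (Finset.ne_of_mem_erase hc)]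
      simp
  have hsub : (Finset.univ : Finset (Fin r → Fin n)).filter (fun φ => φ i = v ∧
      ∀ e ∈ E, ∃ h ∈ H, ∀ a ∈ e, φ a ∈ h.1) ⊆
      X.biUnion (fun f => Fintype.piFinset
        (fun a => ball H (f (G.connectedComponentMk a)) r)) := by
    intro φ hφ
    obtain ⟨-, hv, hE⟩ := Finset.mem_filter.1 hφ
    have hout : ∀ a, G.Reachable a (G.connectedComponentMk a).out := by
      intro a
      apply SimpleGraph.ConnectedComponent.exact
      exact (Quot.out_eq _).symm
    rw [Finset.mem_biUnion]
    refine ⟨fun c => φ c.out, ?_, ?_⟩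
    · rw [Fintype.mem_piFinset]
      intro c
      by_cases hc : c = c0
      · rw [if_pos hc, hc, ← hv]
        exact reach_ball H E φ hE (hout i).symm
      · rw [if_neg hc]; simp
    · rw [Fintype.mem_piFinset]
      intro a
      exact reach_ball H E φ hE (hout a)
  refine (Finset.card_le_card hsub).trans ?_
  refine (Finset.card_biUnion_le_card_mul _ _ ((D ^ r) ^ r) ?_).trans ?_
  · intro f _
    rw [Fintype.card_piFinset]
    refine (Finset.prod_le_pow_card _ _ (D ^ r) (fun a _ => ball_card H D hD _ r)).trans ?_
    simp
  · calc X.card * (D ^ r) ^ r ≤ (D ^ r * n ^ (ncomp E - 1)) * (D ^ r) ^ r :=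
        Nat.mul_le_mul_right _ hX
      _ = _ := by rw [pow_succ]; ring

lemma nbr_card {H : Finset (FE n)} (hH : ∀ h ∈ H, IsFEdge F n h) (y : Fin n) :
    (nbr H y).card ≤ 1 + degFE H y * r := by
  refine (Finset.card_insert_le _ _).trans ?_
  rw [add_comm]
  apply Nat.add_le_add_left
  refine Finset.card_biUnion_le_card_mul _ _ r ?_
  intro h hh
  exact (fe_card1 (hH h (Finset.mem_filter.1 hh).1)).le

/-- The combinatorial heart: bounding the sum by a sum over patterns. -/
lemma sum_bound (hu : 2 ≤ u) (hr : 4 ≤ r) (hFc : ∀ e ∈ F, e.card = u) (hF : Nice u F)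
    {H : Finset (FE n)} (hH : ∀ t ∈ H, IsFEdge F n t) (hav : ¬ HasAvoidable r H)
    (D : ℕ) (hD : ∀ y, (nbr H y).card ≤ D) (v : Fin n) (p : ℝ) (hp : 0 ≤ p) :
    ∑ h ∈ (allFEdges F n \ H).filter (fun h => v ∈ h.1),
        (p ^ ((h.2 \ H.sup Prod.snd).card) - p ^ F.card) ≤
      ∑ E ∈ F.powerset.filter (fun E => E.Nonempty ∧ E ≠ F), ∑ _i : Fin r,
        (((D ^ r) ^ (r + 1) * n ^ (ncomp E - 1) : ℕ) : ℝ) * p ^ (F.card - E.card) := by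
  set Q := (allFEdges F n \ H).filter (fun h => v ∈ h.1) with hQ
  have hex : ∀ h : FE n, ∃ φ : Fin r → Fin n, IsFEdge F n h →
      Function.Injective φ ∧ h.1 = Finset.univ.image φ ∧
        h.2 = F.image (fun e => e.image φ) := by
    intro h
    by_cases hh : IsFEdge F n h
    · obtain ⟨φ, h1, h2⟩ := hh
      refine ⟨φ, fun _ => ⟨φ.injective, ?_, ?_⟩⟩
      · rw [h1, Finset.map_eq_image]
      · rw [h2]; simp only [Finset.map_eq_image]
    · obtain h0 | h0 := isEmpty_or_nonempty (Fin n)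
      · exact (h0.false v).elim
      · exact ⟨fun _ => Classical.arbitrary _, fun h => absurd h hh⟩
  choose Φ hΦ using hex
  let pat : FE n → Finset (Finset (Fin r)) := fun h =>
    F.filter (fun e => e.image (Φ h) ∈ H.sup Prod.snd)
  have hQF : ∀ h ∈ Q, IsFEdge F n h ∧ h ∉ H ∧ v ∈ h.1 := by
    intro h hh
    rw [hQ, Finset.mem_filter, Finset.mem_sdiff, allFEdges, Finset.mem_filter] at hh
    exact ⟨hh.1.1.2, hh.1.2, hh.2⟩
  clear_value Q
  have hpatc : ∀ h ∈ Q, (h.2 \ H.sup Prod.snd).card = F.card - (pat h).card := by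
    intro h hh
    obtain ⟨hinj, h1, h2⟩ := hΦ h (hQF h hh).1
    have himg : h.2 \ H.sup Prod.snd = (F \ pat h).image (fun e => e.image (Φ h)) := by
      rw [h2]
      ext e
      simp only [Finset.mem_sdiff, Finset.mem_image, pat, Finset.mem_filter]
      constructor
      · rintro ⟨⟨e', he', rfl⟩, hn⟩
        exact ⟨e', ⟨he', fun h => hn h.2⟩, rfl⟩
      · rintro ⟨e', ⟨he', hn⟩, rfl⟩
        exact ⟨⟨e', he', rfl⟩, fun h => hn ⟨he', h⟩⟩
    rw [himg, Finset.card_image_of_injective _ (Finset.image_injective hinj),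
      Finset.card_sdiff_of_subset (Finset.filter_subset _ _)]
  have hpatF : ∀ h ∈ Q, pat h ≠ F := by
    intro h hh heq
    obtain ⟨hfe, hnH, -⟩ := hQF h hh
    obtain ⟨hinj, h1, h2⟩ := hΦ h hfe
    apply hnH
    refine no_extra hu hr hFc hF hH hav hfe ?_
    rw [h2]
    intro e he
    obtain ⟨e', he', rfl⟩ := Finset.mem_image.1 he
    rw [← heq] at he'
    exact (Finset.mem_filter.1 he').2
  set P := F.powerset.filter (fun E => E.Nonempty ∧ E ≠ F) with hP
  set Q' := Q.filter (fun h => (pat h).Nonempty) with hQ'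
  have step1 : ∑ h ∈ Q, (p ^ ((h.2 \ H.sup Prod.snd).card) - p ^ F.card) ≤
      ∑ h ∈ Q', p ^ (F.card - (pat h).card) := by
    rw [hQ', Finset.sum_filter]
    apply Finset.sum_le_sum
    intro h hh
    rw [hpatc h hh]
    split_ifs with hne
    · have := pow_nonneg hp F.card
      linarith
    · rw [Finset.not_nonempty_iff_eq_empty] at hne
      simp [hne]
  refine step1.trans ?_
  have hmaps : ∀ h ∈ Q', pat h ∈ P := by
    intro h hh
    obtain ⟨hh1, hh2⟩ := Finset.mem_filter.1 hh
    rw [hP, Finset.mem_filter, Finset.mem_powerset]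
    exact ⟨Finset.filter_subset _ _, hh2, hpatF h hh1⟩
  rw [← Finset.sum_fiberwise_of_maps_to hmaps]
  refine Finset.sum_le_sum ?_
  intro E hE
  rw [Finset.sum_congr rfl (g := fun _ => p ^ (F.card - E.card))
    (fun h hh => by rw [(Finset.mem_filter.1 hh).2]), Finset.sum_const, nsmul_eq_mul,
    ← Finset.sum_mul]
  refine mul_le_mul_of_nonneg_right ?_ (pow_nonneg hp _)
  rw [← Nat.cast_sum]
  refine Nat.cast_le.2 ?_
  -- inject copies into functions
  let Y : Fin r → Finset (Fin r → Fin n) := fun i =>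
    (Finset.univ : Finset (Fin r → Fin n)).filter (fun φ => φ i = v ∧
      ∀ e ∈ E, ∃ h ∈ H, ∀ a ∈ e, φ a ∈ h.1)
  have hcard : (Q'.filter (fun h => pat h = E)).card ≤ (Finset.univ.biUnion Y).card := by
    refine Finset.card_le_card_of_injOn Φ ?_ ?_
    · intro h hh
      obtain ⟨hh1, rfl⟩ := Finset.mem_filter.1 hh
      obtain ⟨hfe, hnH, hv⟩ := hQF h (Finset.mem_filter.1 hh1).1
      obtain ⟨hinj, h1, h2⟩ := hΦ h hfe
      rw [h1] at hv
      obtain ⟨i, -, hi⟩ := Finset.mem_image.1 hv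
      rw [Finset.mem_coe, Finset.mem_biUnion]
      refine ⟨i, Finset.mem_univ _, Finset.mem_filter.2 ⟨Finset.mem_univ _, hi, ?_⟩⟩
      intro e he
      obtain ⟨t, ht, het⟩ := Finset.mem_sup.1 (Finset.mem_filter.1 he).2
      exact ⟨t, ht, fun a ha => fe_sub (hH t ht) het (Finset.mem_image_of_mem _ ha)⟩
    · intro h hh k hk heq
      have hfh := (hQF h (Finset.mem_filter.1 (Finset.mem_filter.1 hh).1).1).1
      have hfk := (hQF k (Finset.mem_filter.1 (Finset.mem_filter.1 hk).1).1).1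
      obtain ⟨-, h1, h2⟩ := hΦ h hfh
      obtain ⟨-, k1, k2⟩ := hΦ k hfk
      refine Prod.ext ?_ ?_
      · rw [h1, k1, heq]
      · rw [h2, k2, heq]
  refine hcard.trans (Finset.card_biUnion_le.trans ?_)
  refine Finset.sum_le_sum ?_
  intro i _
  exact count_bound H D hD E i v

end Counting
section Asymp

variable {r : ℕ}

lemma Mnum_le (F : Finset (Finset (Fin r))) (n : ℕ) : Mnum F n ≤ n ^ r := by
  have : allFEdges F n ⊆ (Finset.univ : Finset (Fin r ↪ Fin n)).image
      (fun φ => (Finset.univ.map φ, F.image (fun e => e.map φ))) := by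
    intro h hh
    obtain ⟨φ, h1, h2⟩ := (Finset.mem_filter.1 hh).2
    exact Finset.mem_image.2 ⟨φ, Finset.mem_univ _, Prod.ext h1.symm h2.symm⟩
  refine (Finset.card_le_card this).trans (Finset.card_image_le.trans ?_)
  rw [Finset.card_univ, Fintype.card_embedding_eq]
  simpa using Nat.descFactorial_le_pow n r

lemma autCard_le (F : Finset (Finset (Fin r))) : autCard F ≤ r.factorial := by
  refine (Fintype.card_subtype_le _).trans ?_
  simp [Fintype.card_perm]

lemma choose_lower (hr : 4 ≤ r) {n : ℕ} (hn : 2 * r ≤ n) :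
    (n : ℝ) ^ (r - 1) / (2 ^ (r - 1) * ((r - 1).factorial : ℝ)) ≤ ((n - 1).choose (r - 1) : ℝ) := by
  have h := Nat.pow_le_choose (α := ℝ) (r - 1) (n - 1)
  refine le_trans ?_ h
  have h2 : (n : ℝ) / 2 ≤ ((n - 1 + 1 - (r - 1) : ℕ) : ℝ) := by
    have : n ≤ 2 * (n - 1 + 1 - (r - 1)) := by omega
    have : (n : ℝ) ≤ 2 * ((n - 1 + 1 - (r - 1) : ℕ) : ℝ) := by exact_mod_cast this
    linarith
  rw [← div_div, ← div_pow]
  gcongr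

lemma g_le_log {g : ℕ → ℝ} (hg : GoodG g) :
    ∀ᶠ n : ℕ in atTop, 0 ≤ g n ∧ g n ≤ Real.log n := by
  have hlog : Tendsto (fun n : ℕ => Real.log (n : ℝ)) atTop atTop :=
    Real.tendsto_log_atTop.comp tendsto_natCast_atTop_atTop
  have hloglog := (Real.tendsto_log_atTop.comp hlog)
  filter_upwards [hg.1.eventually_ge_atTop 0, hg.2.bound (show (0 : ℝ) < 1 by norm_num),
    hlog.eventually_ge_atTop 0, hloglog.eventually_ge_atTop 1] with n h0 h1 h2 h3
  refine ⟨h0, ?_⟩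
  simp only [Function.comp] at h3
  rw [one_mul, Real.norm_eq_abs, Real.norm_eq_abs, abs_of_nonneg h0,
    abs_of_nonneg (by positivity)] at h1
  exact h1.trans (div_le_self h2 h3)

lemma piPlus_bounds (hr : 4 ≤ r) (F : Finset (Finset (Fin r))) {g : ℕ → ℝ} (hg : GoodG g) :
    ∃ K : ℝ, 0 < K ∧ ∀ᶠ n : ℕ in atTop, 0 ≤ piPlus F g n ∧
      piPlus F g n ≤ K * Real.log n / (n : ℝ) ^ (r - 1) := by
  refine ⟨2 * (2 ^ (r - 1) * ((r - 1).factorial : ℝ)), by positivity, ?_⟩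
  filter_upwards [g_le_log hg, eventually_ge_atTop (2 * r)] with n hgn hn
  have hnpos : (0 : ℝ) < n := by exact_mod_cast (by omega : 0 < n)
  have hC := choose_lower hr hn
  have hlog : 0 ≤ Real.log n := Real.log_natCast_nonneg n
  have haut : (autCard F : ℝ) / (r.factorial : ℝ) ≤ 1 := by
    rw [div_le_one (by positivity)]
    exact_mod_cast autCard_le F
  have hlg : 0 ≤ Real.log n + g n := by linarith
  unfold piPlus
  refine ⟨by positivity, ?_⟩
  calc _ ≤ 1 * ((Real.log n + g n) / ((n - 1).choose (r - 1) : ℝ)) := by gcongr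
    _ ≤ (2 * Real.log n) / ((n : ℝ) ^ (r - 1) / (2 ^ (r - 1) * ((r - 1).factorial : ℝ))) := by
        rw [one_mul]
        gcongr
        linarith
    _ = _ := by field_simp

lemma polylog_le (C : ℝ) (m : ℕ) {ε : ℝ} (hε : 0 < ε) :
    ∀ᶠ n : ℕ in atTop, C * Real.log n ^ m ≤ (n : ℝ) ^ ε := by
  have h := (isLittleO_log_rpow_rpow_atTop (m : ℝ) hε).comp_tendsto
    (tendsto_natCast_atTop_atTop (R := ℝ))
  have hc : (0 : ℝ) < 1 / (|C| + 1) := by positivity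
  filter_upwards [h.bound hc] with n hn
  simp only [Function.comp, Real.rpow_natCast] at hn
  have hlog : 0 ≤ Real.log n := Real.log_natCast_nonneg n
  rw [Real.norm_of_nonneg (by positivity), Real.norm_of_nonneg (by positivity)] at hn
  have h1 : (|C| + 1) * Real.log n ^ m ≤ (n : ℝ) ^ ε := by
    rw [div_mul_eq_mul_div, one_mul, le_div_iff₀ (by positivity)] at hn
    linarith
  refine le_trans ?_ h1
  gcongr
  linarith [le_abs_self C]

/-- Per-pattern estimate. -/
lemma term_bound {s e c n r : ℕ} (hr : 1 ≤ r) (hn : 1 ≤ n) (hs : 0 < s) (hes : e ≤ s) (hc : 1 ≤ c)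
    (hrank : e * (r - 1) + 1 + s * c ≤ s * r) {p ℓ : ℝ} (hp : 0 ≤ p) (hℓ : 1 ≤ ℓ)
    (hps : p ^ s ≤ ℓ / (n : ℝ) ^ (r - 1)) :
    (n : ℝ) ^ (c - 1) * p ^ (s - e) ≤ ℓ * (n : ℝ) ^ (-(1 : ℝ) / s) := by
  have hn' : (1 : ℝ) ≤ n := by exact_mod_cast hn
  have hn0 : (0 : ℝ) < n := by linarith
  have hs' : (0 : ℝ) < s := by exact_mod_cast hs
  set θ : ℝ := ((s - e : ℕ) : ℝ) / s with hθ
  have hθ0 : 0 ≤ θ := by positivity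
  have hθ1 : θ ≤ 1 := by
    rw [hθ, div_le_one hs']
    exact_mod_cast Nat.sub_le s e
  have h1 : p ^ (s - e) = (p ^ s) ^ θ := by
    rw [← Real.rpow_natCast p s, ← Real.rpow_mul hp, hθ, mul_div_cancel₀ _ hs'.ne',
      Real.rpow_natCast]
  have h2 : (p ^ s) ^ θ ≤ ℓ * (n : ℝ) ^ (-((r - 1 : ℕ) : ℝ) * θ) := by
    calc (p ^ s) ^ θ ≤ (ℓ / (n : ℝ) ^ (r - 1)) ^ θ :=
          Real.rpow_le_rpow (by positivity) hps hθ0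
      _ = ℓ ^ θ * (n : ℝ) ^ (-((r - 1 : ℕ) : ℝ) * θ) := by
          rw [div_eq_mul_inv, Real.mul_rpow (by linarith) (by positivity), Real.rpow_mul hn0.le,
            Real.rpow_neg hn0.le, Real.rpow_natCast]
      _ ≤ ℓ ^ (1 : ℝ) * (n : ℝ) ^ (-((r - 1 : ℕ) : ℝ) * θ) := by
          gcongr
      _ = _ := by rw [Real.rpow_one]
  rw [h1]
  calc (n : ℝ) ^ (c - 1) * (p ^ s) ^ θ
      ≤ (n : ℝ) ^ (c - 1) * (ℓ * (n : ℝ) ^ (-((r - 1 : ℕ) : ℝ) * θ)) := by gcongr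
    _ = ℓ * (n : ℝ) ^ (((c - 1 : ℕ) : ℝ) + -((r - 1 : ℕ) : ℝ) * θ) := by
        rw [Real.rpow_add hn0, Real.rpow_natCast]; ring
    _ ≤ _ := by
        gcongr
        rw [hθ, le_div_iff₀ hs', add_mul, mul_assoc, div_mul_cancel₀ _ hs'.ne']
        obtain ⟨q, rfl⟩ : ∃ q, r = q + 1 := ⟨r - 1, by omega⟩
        obtain ⟨k, rfl⟩ : ∃ k, c = k + 1 := ⟨c - 1, by omega⟩
        simp only [Nat.add_sub_cancel] at hrank ⊢
        rw [Nat.cast_sub hes]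
        have : (e : ℝ) * q + 1 + s * (k + 1) ≤ s * (q + 1) := by exact_mod_cast hrank
        linarith

end Asymp
/-- The deterministic combinatorial bound: for any `δ > 0`, for any
well-behaved `F`-graph `H₀` and low-degree vertex `v` of `H₀`, the sum over `F`-edges
`h ∉ H₀` containing `v` of `p₊^{|E_j \ E(G₀)|} - p₊^s` is at most `n^{-1/s + ε}`. -/
theorem statement_8 (u r : ℕ) (hu : 2 ≤ u) (hr : 4 ≤ r)
    (F : Finset (Finset (Fin r))) (hFcard : ∀ e ∈ F, e.card = u) (hF : Nice u F)
    (δ : ℝ) (hδ : 0 < δ) (g : ℕ → ℝ) (hg : GoodG g) :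
    ∀ ε : ℝ, 0 < ε → ∃ n₀ : ℕ, ∀ n : ℕ, n₀ ≤ n →
      ∀ H₀ : Finset (FE n), (∀ h ∈ H₀, IsFEdge F n h) →
        (∀ v : Fin n, (degFE H₀ v : ℝ) ≤
          (r : ℝ) / n * (Mnum F n : ℝ) * piPlus F g n +
            max ((r : ℝ) / n * (Mnum F n : ℝ) * piPlus F g n) (3 * Real.log n)) →
        ¬ HasAvoidable r H₀ →
        ∀ v : Fin n, (degFE H₀ v : ℝ) ≤ 7 * g n →
          ∑ h ∈ (allFEdges F n \ H₀).filter (fun h => v ∈ h.1),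
              (pPlus F g δ n ^ ((h.2 \ H₀.sup Prod.snd).card) - pPlus F g δ n ^ F.card)
            ≤ (n : ℝ) ^ (-(1 : ℝ) / (F.card : ℝ) + ε) := by
  intro ε hε
  obtain ⟨K, hK, hpi⟩ := piPlus_bounds hr F hg
  set L : ℝ := 2 * r * K + 3 + 2 * K with hL
  have hLpos : 0 < L := by positivity
  have hL1 : 1 ≤ L := by
    have : 0 ≤ 2 * (r : ℝ) * K := by positivity
    linarith
  set m : ℕ := r * (r + 1) + 1 with hm
  set C : ℝ := (2 ^ F.card * r) * ((1 + L * r) ^ (r * (r + 1)) * L) with hC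
  have hpoly := polylog_le C m hε
  have hnd : ∀ᶠ n : ℕ in atTop, (n : ℝ) ^ (-δ) ≤ 1 / 2 :=
    (((tendsto_rpow_neg_atTop hδ).comp tendsto_natCast_atTop_atTop).eventually_le_const
      (by norm_num : (0 : ℝ) < 1 / 2))
  have hlog1 : ∀ᶠ n : ℕ in atTop, 1 ≤ Real.log (n : ℝ) :=
    (Real.tendsto_log_atTop.comp tendsto_natCast_atTop_atTop).eventually_ge_atTop 1
  have hFpos : 0 < F.card := by
    rw [Finset.card_pos]
    by_contra hne
    rw [Finset.not_nonempty_iff_eq_empty] at hne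
    have h := hF.2.1.2 ∅ (by simp) ⟨0, by omega⟩ ⟨1, by omega⟩ (by simp) (by simp)
    rcases Relation.ReflTransGen.cases_head h with h | ⟨c, ⟨e, he, -⟩, -⟩
    · simp at h
    · simp [hne] at he
  obtain ⟨n₀, hn₀⟩ := eventually_atTop.1
    (hpi.and (hpoly.and (hnd.and (hlog1.and (eventually_ge_atTop 1)))))
  refine ⟨n₀, fun n hn H hH hdeg hav v _ => ?_⟩
  obtain ⟨⟨hpi0, hpi1⟩, hpo, hndn, hlogn, hn1⟩ := hn₀ n hn
  have hn0 : (0 : ℝ) < n := by exact_mod_cast hn1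
  set l := Real.log (n : ℝ) with hl
  set p := pPlus F g δ n with hp
  have hden : 0 < 1 - (n : ℝ) ^ (-δ) := by linarith
  have hp0 : 0 ≤ p := by
    rw [hp, pPlus]
    exact Real.rpow_nonneg (div_nonneg hpi0 hden.le) _
  have hps : p ^ F.card ≤ (L * l) / (n : ℝ) ^ (r - 1) := by
    rw [hp, pPlus, ← Real.rpow_natCast, ← Real.rpow_mul (div_nonneg hpi0 hden.le),
      one_div_mul_cancel (by positivity), Real.rpow_one, div_le_iff₀ hden]
    calc piPlus F g n ≤ K * l / (n : ℝ) ^ (r - 1) := hpi1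
      _ = (2 * K * l) / (n : ℝ) ^ (r - 1) * (1 / 2) := by ring
      _ ≤ (L * l) / (n : ℝ) ^ (r - 1) * (1 - (n : ℝ) ^ (-δ)) := by
          gcongr
          · rw [hL]
            have : 0 ≤ 2 * (r : ℝ) * K := by positivity
            linarith
          · linarith
  have hdegL : ∀ y, (degFE H y : ℝ) ≤ L * l := by
    intro y
    have h1 : (r : ℝ) / n * (Mnum F n : ℝ) * piPlus F g n ≤ r * K * l := by
      calc (r : ℝ) / n * (Mnum F n : ℝ) * piPlus F g n
          ≤ (r : ℝ) / n * (n : ℝ) ^ r * (K * l / (n : ℝ) ^ (r - 1)) := by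
            gcongr
            exact_mod_cast Mnum_le F n
        _ = r * K * l := by
            obtain ⟨q, rfl⟩ : ∃ q, r = q + 1 := ⟨r - 1, by omega⟩
            simp only [Nat.add_sub_cancel]
            field_simp
            ring
    have h2 : 0 ≤ r * K * l := by positivity
    have h3 := hdeg y
    have h4 : max ((r : ℝ) / n * (Mnum F n : ℝ) * piPlus F g n) (3 * l) ≤ r * K * l + 3 * l :=
      max_le (by linarith) (by linarith)
    have h5 : L * l = 2 * (r * K * l) + 3 * l + 2 * (K * l) := by rw [hL]; ring
    have h6 : 0 ≤ K * l := by positivity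
    linarith
  set D : ℕ := 1 + ⌊L * l⌋₊ * r with hDdef
  have hD : ∀ y, (nbr H y).card ≤ D := by
    intro y
    refine (nbr_card hH y).trans ?_
    have : degFE H y ≤ ⌊L * l⌋₊ := Nat.le_floor (hdegL y)
    exact Nat.add_le_add_left (Nat.mul_le_mul_right _ this) _
  have hDl : (D : ℝ) ≤ (1 + L * r) * l := by
    have h1 : (⌊L * l⌋₊ : ℝ) ≤ L * l := Nat.floor_le (by positivity)
    rw [hDdef]
    push_cast
    have h2 := mul_le_mul_of_nonneg_right h1 (Nat.cast_nonneg (α := ℝ) r)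
    linarith
  have hLl : 1 ≤ L * l := one_le_mul_of_one_le_of_one_le hL1 hlogn
  refine (sum_bound hu hr hFcard hF hH hav D hD v p hp0).trans ?_
  have hterm : ∀ E ∈ F.powerset.filter (fun E => E.Nonempty ∧ E ≠ F), ∀ i : Fin r,
      (((D ^ r) ^ (r + 1) * n ^ (ncomp E - 1) : ℕ) : ℝ) * p ^ (F.card - E.card) ≤
      ((1 + L * r) * l) ^ (r * (r + 1)) * ((L * l) * (n : ℝ) ^ (-(1 : ℝ) / F.card)) := by
    intro E hE i
    rw [Finset.mem_filter, Finset.mem_powerset] at hE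
    have hrank := rank_bound hu hFcard hF.1 hE.1 hE.2.1 hE.2.2
    have hc1 : 1 ≤ ncomp E := Fintype.card_pos_iff.2 ⟨(secGraph E).connectedComponentMk i⟩
    have ht := term_bound (by omega) hn1 hFpos (Finset.card_le_card hE.1) hc1 hrank hp0 hLl hps
    push_cast
    rw [mul_assoc, ← pow_mul]
    gcongr
  refine (Finset.sum_le_sum (fun E hE => Finset.sum_le_sum (fun i _ => hterm E hE i))).trans ?_
  rw [Finset.sum_const, Finset.sum_const, nsmul_eq_mul, nsmul_eq_mul, Finset.card_univ,
    Fintype.card_fin]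
  have hcardP : ((F.powerset.filter (fun E => E.Nonempty ∧ E ≠ F)).card : ℝ) ≤ 2 ^ F.card := by
    have := Finset.card_filter_le F.powerset (fun E => E.Nonempty ∧ E ≠ F)
    rw [Finset.card_powerset] at this
    exact_mod_cast this
  rw [Real.rpow_add hn0]
  calc _ ≤ (2 : ℝ) ^ F.card * ((r : ℝ) * (((1 + L * r) * l) ^ (r * (r + 1)) *
          ((L * l) * (n : ℝ) ^ (-(1 : ℝ) / F.card)))) := by gcongr
    _ = (n : ℝ) ^ (-(1 : ℝ) / F.card) * (C * l ^ m) := by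
        rw [hC, hm, mul_pow, pow_succ l]; ring
    _ ≤ _ := by gcongr
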